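/- Let f₁, f₂ : ℤ → ℕ be finitely supported with V(f₁) > 0, and suppose that for every integer t ≥ 1 and every elevation h ≥ 1 the run counts agree: n_{t,h}(f₁) = n_{t,h}(f₂). Then V(f₁) = V(f₂), p_k(f₁) = p_k(f₂) for every k ≥ 1, and hence the granulometric indices are equal: GI(f₁) = GI(f₂). -/

import Mathlib

namespace Granulo

/-- Opening of a one-dimensional DEM `f` by a segment of length `k` (closed form):
`(γₖ f)(x) = max{ min{ f(y) : a ≤ y ≤ a+k−1 } : a ≤ x ≤ a+k−1 }`. -/
noncomputable def opening (k : ℕ) (f : ℤ → ℕ) (x : ℤ) : ℕ :=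
  sSup {m : ℕ | ∃ a : ℤ, a ≤ x ∧ x ≤ a + (k : ℤ) - 1 ∧
    m = sInf {n : ℕ | ∃ y : ℤ, a ≤ y ∧ y ≤ a + (k : ℤ) - 1 ∧ n = f y}}

/-- Volume of a one-dimensional DEM. -/
noncomputable def vol (f : ℤ → ℕ) : ℕ := ∑ᶠ x : ℤ, f x

/-- Level set `S_h(f) = {x : f x ≥ h}`. -/
def levelSet (h : ℕ) (f : ℤ → ℕ) : Set ℤ := {x : ℤ | h ≤ f x}

/-- A set of consecutive integers. -/
def IsInterval (R : Set ℤ) : Prop :=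
  ∀ a ∈ R, ∀ b ∈ R, ∀ c : ℤ, a ≤ c → c ≤ b → c ∈ R

/-- `R` is a run of `S`: a maximal nonempty set of consecutive integers contained in `S`. -/
def IsRun (S R : Set ℤ) : Prop :=
  R.Nonempty ∧ R ⊆ S ∧ IsInterval R ∧
    ∀ R' : Set ℤ, R ⊆ R' → R' ⊆ S → IsInterval R' → R' = R

/-- `n_{t,h}(f)`: number of runs of `S_h(f)` of cardinality `t`. -/
noncomputable def runCount (f : ℤ → ℕ) (t h : ℕ) : ℕ :=
  {R : Set ℤ | IsRun (levelSet h f) R ∧ R.ncard = t}.ncard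

/-- Granulometric probability `p_k(f) = (V(γₖ f) − V(γ_{k+1} f))/V(f)`. -/
noncomputable def p (k : ℕ) (f : ℤ → ℕ) : ℝ :=
  ((vol (opening k f) : ℝ) - (vol (opening (k+1) f) : ℝ)) / (vol f : ℝ)

/-- Granulometric index `GI(f) = −Σ_{k≥1} p_k log p_k` (terms with `p_k = 0` are `0`). -/
noncomputable def gi (f : ℤ → ℕ) : ℝ :=
  -∑ᶠ k ∈ Set.Ici (1 : ℕ), p k f * Real.log (p k f)

/-- Volume of a two-dimensional DEM. -/
noncomputable def vol2 (f : ℤ × ℤ → ℕ) : ℕ := ∑ᶠ q : ℤ × ℤ, f q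

/-- Horizontal opening: apply `γₖ` to each row `i ↦ f (i, ·)`. -/
noncomputable def hOpening (k : ℕ) (f : ℤ × ℤ → ℕ) : ℤ × ℤ → ℕ :=
  fun q => opening k (fun j => f (q.1, j)) q.2

/-- Row-wise run count `n_{t,h}^{(i)}(f)`. -/
noncomputable def rowRunCount (f : ℤ × ℤ → ℕ) (i : ℤ) (t h : ℕ) : ℕ :=
  runCount (fun j => f (i, j)) t h

/-- Granulometric probability w.r.t. horizontal openings. -/
noncomputable def p2 (k : ℕ) (f : ℤ × ℤ → ℕ) : ℝ :=
  ((vol2 (hOpening k f) : ℝ) - (vol2 (hOpening (k+1) f) : ℝ)) / (vol2 f : ℝ)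

/-- Granulometric index w.r.t. horizontal openings. -/
noncomputable def gi2 (f : ℤ × ℤ → ℕ) : ℝ :=
  -∑ᶠ k ∈ Set.Ici (1 : ℕ), p2 k f * Real.log (p2 k f)


theorem le_opening_iff {k : ℕ} (hk : 1 ≤ k) (f : ℤ → ℕ) (h : ℕ) (x : ℤ) :
    h ≤ opening k f x ↔ ∃ a : ℤ, a ≤ x ∧ x ≤ a + (k : ℤ) - 1 ∧
      ∀ y : ℤ, a ≤ y → y ≤ a + (k : ℤ) - 1 → h ≤ f y := by
  have hbdd : BddAbove {m : ℕ | ∃ a : ℤ, a ≤ x ∧ x ≤ a + (k : ℤ) - 1 ∧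
      m = sInf {n : ℕ | ∃ y : ℤ, a ≤ y ∧ y ≤ a + (k : ℤ) - 1 ∧ n = f y}} := by
    refine ⟨f x, ?_⟩
    rintro m ⟨a, ha, hb, rfl⟩
    exact Nat.sInf_le ⟨x, ha, hb, rfl⟩
  constructor
  · intro hle
    obtain ⟨a, ha, hb, hm⟩ := Nat.sSup_mem (⟨_, x, le_rfl, by omega, rfl⟩ :
      {m : ℕ | ∃ a : ℤ, a ≤ x ∧ x ≤ a + (k : ℤ) - 1 ∧
        m = sInf {n : ℕ | ∃ y : ℤ, a ≤ y ∧ y ≤ a + (k : ℤ) - 1 ∧ n = f y}}.Nonempty) hbdd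
    refine ⟨a, ha, hb, fun y hy hy' => hle.trans ?_⟩
    exact hm.le.trans (Nat.sInf_le ⟨y, hy, hy', rfl⟩)
  · rintro ⟨a, ha, hb, hall⟩
    refine le_trans ?_ (le_csSup hbdd ⟨a, ha, hb, rfl⟩)
    refine le_csInf ⟨f x, x, ha, hb, rfl⟩ ?_
    rintro n ⟨y, hy, hy', rfl⟩
    exact hall y hy hy'

theorem opening_le {k : ℕ} (hk : 1 ≤ k) (f : ℤ → ℕ) (x : ℤ) : opening k f x ≤ f x := by
  obtain ⟨a, ha, hb, hall⟩ := (le_opening_iff hk f _ x).1 le_rfl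
  exact hall x ha hb

theorem opening_one (f : ℤ → ℕ) : opening 1 f = f := by
  funext x
  refine le_antisymm (opening_le le_rfl f x) ((le_opening_iff le_rfl f _ x).2 ?_)
  refine ⟨x, le_rfl, by simp, fun y hy hy' => ?_⟩
  obtain rfl : y = x := by push_cast at hy'; omega
  exact le_rfl

/-- The connected component of `x` in `S`: the points joined to `x` by consecutive integers
of `S`. -/
def component (S : Set ℤ) (x : ℤ) : Set ℤ := {y | ∀ z, min x y ≤ z → z ≤ max x y → z ∈ S}

theorem mem_component_self {S : Set ℤ} {x : ℤ} (hx : x ∈ S) : x ∈ component S x := by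
  intro z hz hz'
  obtain rfl : z = x := by omega
  exact hx

theorem component_subset (S : Set ℤ) (x : ℤ) : component S x ⊆ S :=
  fun y hy => hy y (min_le_right _ _) (le_max_right _ _)

theorem isInterval_component (S : Set ℤ) (x : ℤ) : IsInterval (component S x) := by
  intro a ha b hb c hac hcb z hz hz'
  by_cases h : min x a ≤ z ∧ z ≤ max x a
  · exact ha z h.1 h.2
  · exact hb z (by omega) (by omega)

theorem IsInterval.subset_component {S R : Set ℤ} (hR : IsInterval R) (hRS : R ⊆ S) {x : ℤ}
    (hx : x ∈ R) : R ⊆ component S x := by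
  intro y hy z hz hz'
  refine hRS ?_
  rcases le_total x y with h | h
  · exact hR x hx y hy z (by omega) (by omega)
  · exact hR y hy x hx z (by omega) (by omega)

theorem isRun_component {S : Set ℤ} {x : ℤ} (hx : x ∈ S) : IsRun S (component S x) :=
  ⟨⟨x, mem_component_self hx⟩, component_subset S x, isInterval_component S x,
    fun _ hsub hS hI => (hI.subset_component hS (hsub (mem_component_self hx))).antisymm hsub⟩

theorem IsRun.component_eq {S R : Set ℤ} (hR : IsRun S R) {x : ℤ} (hx : x ∈ R) :
    component S x = R :=
  hR.2.2.2 _ (hR.2.2.1.subset_component hR.2.1 hx) (component_subset S x)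
    (isInterval_component S x)

theorem le_ncard_component_iff {S : Set ℤ} (hS : S.Finite) {k : ℕ} (hk : 1 ≤ k) (x : ℤ) :
    (∃ a : ℤ, a ≤ x ∧ x ≤ a + (k : ℤ) - 1 ∧ ∀ y : ℤ, a ≤ y → y ≤ a + (k : ℤ) - 1 → y ∈ S) ↔
      x ∈ S ∧ k ≤ (component S x).ncard := by
  have hC : (component S x).Finite := hS.subset (component_subset S x)
  constructor
  · rintro ⟨a, ha, hb, hall⟩
    refine ⟨hall x ha hb, ?_⟩
    have hsub : Set.Icc a (a + k - 1) ⊆ component S x := by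
      refine IsInterval.subset_component ?_ (fun y hy => hall y hy.1 hy.2) ⟨ha, hb⟩
      exact fun b hb c hc d hbd hdc => ⟨hb.1.trans hbd, hdc.trans hc.2⟩
    have hcard := Set.ncard_le_ncard hsub hC
    rw [← Finset.coe_Icc, Set.ncard_coe_finset, Int.card_Icc] at hcard
    omega
  · rintro ⟨hx, hcard⟩
    have hxC := mem_component_self hx
    obtain ⟨m, hm, hmin⟩ := Set.exists_min_image _ id hC ⟨x, hxC⟩
    obtain ⟨M, hM, hmax⟩ := Set.exists_max_image _ id hC ⟨x, hxC⟩
    simp only [id] at hmin hmax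
    have hsub : component S x ⊆ Set.Icc m M := fun y hy => ⟨hmin y hy, hmax y hy⟩
    have hle := Set.ncard_le_ncard hsub (Set.finite_Icc m M)
    rw [← Finset.coe_Icc, Set.ncard_coe_finset, Int.card_Icc] at hle
    have hmx := hmin x hxC
    have hxM := hmax x hxC
    refine ⟨min x (M - k + 1), by omega, by omega, fun y hy hy' => component_subset S x ?_⟩
    exact isInterval_component S x m hm M hM y (by omega) (by omega)

theorem ncard_component_eq_mul {S : Set ℤ} (hS : S.Finite) (t : ℕ) :
    {x | x ∈ S ∧ (component S x).ncard = t}.ncard =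
      t * {R : Set ℤ | IsRun S R ∧ R.ncard = t}.ncard := by
  classical
  have hfin : {x | x ∈ S ∧ (component S x).ncard = t}.Finite := hS.subset fun x hx => hx.1
  have himage : {R : Set ℤ | IsRun S R ∧ R.ncard = t} =
      hfin.toFinset.image (component S) := by
    ext R
    simp only [Set.mem_ofPred_eq, Finset.coe_image, Set.Finite.coe_toFinset, Set.mem_image]
    constructor
    · rintro ⟨hR, ht⟩
      obtain ⟨x, hx⟩ := hR.1
      exact ⟨x, ⟨hR.2.1 hx, by rw [hR.component_eq hx, ht]⟩, hR.component_eq hx⟩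
    · rintro ⟨x, ⟨hx, ht⟩, rfl⟩
      exact ⟨isRun_component hx, ht⟩
  rw [himage, Set.ncard_coe_finset, Set.ncard_eq_toFinset_card _ hfin,
    Finset.card_eq_sum_card_image (component S), mul_comm]
  refine Finset.sum_const_nat fun R hR => ?_
  obtain ⟨hrun, ht⟩ : R ∈ {R : Set ℤ | IsRun S R ∧ R.ncard = t} := himage ▸ hR
  refine Eq.trans ?_ ht
  rw [← Set.ncard_coe_finset]
  congr 1
  ext y
  simp only [Finset.coe_filter, Set.Finite.mem_toFinset, Set.mem_ofPred_eq]
  constructor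
  · rintro ⟨⟨hy, -⟩, rfl⟩
    exact mem_component_self hy
  · intro hy
    have heq := hrun.component_eq hy
    exact ⟨⟨hrun.2.1 hy, by rw [heq, ht]⟩, heq⟩

theorem vol_eq_sum_card {g : ℤ → ℕ} {T : Finset ℤ} (hT : Function.support g ⊆ T) {H : ℕ}
    (hH : ∀ x, g x ≤ H) :
    vol g = ∑ h ∈ Finset.Icc 1 H, (T.filter fun x => h ≤ g x).card := by
  rw [vol, finsum_eq_sum_of_support_subset g hT]
  simp_rw [Finset.card_filter]
  rw [Finset.sum_comm]
  refine Finset.sum_congr rfl fun x _ => ?_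
  rw [← Finset.card_filter]
  have : (Finset.Icc 1 H).filter (fun h => h ≤ g x) = Finset.Icc 1 (g x) := by
    ext h
    have := hH x
    simp only [Finset.mem_filter, Finset.mem_Icc]
    omega
  rw [this, Nat.card_Icc, Nat.add_sub_cancel]

theorem vol_opening {f : ℤ → ℕ} {T : Finset ℤ} (hT : Function.support f ⊆ T) {H : ℕ}
    (hH : ∀ x, f x ≤ H) {k : ℕ} (hk : 1 ≤ k) {N : ℕ} (hN : T.card ≤ N) :
    vol (opening k f) = ∑ h ∈ Finset.Icc 1 H, ∑ t ∈ Finset.Icc k N, t * runCount f t h := by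
  have hsupp : Function.support (opening k f) ⊆ T := fun x hx => hT fun h0 =>
    hx (Nat.le_zero.1 ((opening_le hk f x).trans h0.le))
  rw [vol_eq_sum_card hsupp fun x => (opening_le hk f x).trans (hH x)]
  refine Finset.sum_congr rfl fun h hh => ?_
  rw [Finset.mem_Icc] at hh
  have hST : levelSet h f ⊆ T := fun x hx => hT (by
    have : h ≤ f x := hx
    rw [Function.mem_support]
    omega)
  have hS : (levelSet h f).Finite := T.finite_toSet.subset hST
  have hmem : ∀ x, h ≤ opening k f x ↔
      x ∈ levelSet h f ∧ k ≤ (component (levelSet h f) x).ncard := fun x =>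
    (le_opening_iff hk f h x).trans (le_ncard_component_iff hS hk x)
  rw [Finset.card_eq_sum_card_fiberwise (f := fun x => (component (levelSet h f) x).ncard)
    (t := Finset.Icc k N)]
  · refine Finset.sum_congr rfl fun t ht => ?_
    rw [runCount, ← ncard_component_eq_mul hS, ← Set.ncard_coe_finset]
    congr 1
    ext x
    rw [Finset.mem_Icc] at ht
    simp only [Finset.coe_filter, Finset.mem_filter, Set.mem_ofPred_eq, hmem]
    constructor
    · rintro ⟨⟨-, hx, -⟩, hxt⟩
      exact ⟨hx, hxt⟩
    · rintro ⟨hx, hxt⟩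
      exact ⟨⟨hST hx, hx, hxt ▸ ht.1⟩, hxt⟩
  · intro x hx
    simp only [Finset.coe_filter, Set.mem_ofPred_eq, hmem] at hx
    have hle := Set.ncard_le_ncard ((component_subset (levelSet h f) x).trans hST)
      T.finite_toSet
    rw [Set.ncard_coe_finset] at hle
    simpa using ⟨hx.2.2, hle.trans hN⟩

theorem vol_opening_eq_of_runCount_eq {f₁ f₂ : ℤ → ℕ}
    (hf₁ : (Function.support f₁).Finite) (hf₂ : (Function.support f₂).Finite)
    (hrun : ∀ t h : ℕ, 1 ≤ t → 1 ≤ h → runCount f₁ t h = runCount f₂ t h)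
    {k : ℕ} (hk : 1 ≤ k) : vol (opening k f₁) = vol (opening k f₂) := by
  classical
  have hbound : ∀ f : ℤ → ℕ, ∀ hf : (Function.support f).Finite, ∀ x,
      f x ≤ ∑ y ∈ hf.toFinset, f y := by
    intro f hf x
    by_cases hx : f x = 0
    · omega
    · exact Finset.single_le_sum (f := f) (fun _ _ => Nat.zero_le _) (by simpa using hx)
  set H := max (∑ y ∈ hf₁.toFinset, f₁ y) (∑ y ∈ hf₂.toFinset, f₂ y)
  set N := max hf₁.toFinset.card hf₂.toFinset.card
  rw [vol_opening (T := hf₁.toFinset) (by simp)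
      (fun x => (hbound f₁ hf₁ x).trans (le_max_left _ _) : ∀ x, f₁ x ≤ H) hk
      (le_max_left _ _ : _ ≤ N),
    vol_opening (T := hf₂.toFinset) (by simp)
      (fun x => (hbound f₂ hf₂ x).trans (le_max_right _ _) : ∀ x, f₂ x ≤ H) hk
      (le_max_right _ _ : _ ≤ N)]
  refine Finset.sum_congr rfl fun h hh => Finset.sum_congr rfl fun t ht => ?_
  rw [Finset.mem_Icc] at hh ht
  rw [hrun t h (hk.trans ht.1) hh.1]

/-- if all run counts `n_{t,h}` of `f₁` and `f₂` agree (for `t, h ≥ 1`),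
then the volumes, the granulometric probabilities and the granulometric indices agree. -/
theorem gi_invariant_of_runCount_eq (f₁ f₂ : ℤ → ℕ)
    (hf₁ : (Function.support f₁).Finite) (hf₂ : (Function.support f₂).Finite)
    (hpos : 0 < vol f₁)
    (hrun : ∀ t h : ℕ, 1 ≤ t → 1 ≤ h → runCount f₁ t h = runCount f₂ t h) :
    vol f₁ = vol f₂ ∧ (∀ k : ℕ, 1 ≤ k → p k f₁ = p k f₂) ∧ gi f₁ = gi f₂ := by
  have hvol : ∀ k : ℕ, 1 ≤ k → vol (opening k f₁) = vol (opening k f₂) := fun _ hk =>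
    vol_opening_eq_of_runCount_eq hf₁ hf₂ hrun hk
  have hV : vol f₁ = vol f₂ := by simpa only [opening_one] using hvol 1 le_rfl
  have hp : ∀ k : ℕ, 1 ≤ k → p k f₁ = p k f₂ := fun k hk => by
    rw [p, p, hV, hvol k hk, hvol (k + 1) (by omega)]
  refine ⟨hV, hp, ?_⟩
  rw [gi, gi]
  congr 1
  exact finsum_mem_congr rfl fun k hk => by rw [hp k hk]

end Granulo
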